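/- The sequence (α_k) decays doubly exponentially: there exist constants c > 0 and C > 0 such that α_k ≤ C·exp(−c·2^k) for all k ≥ 1. -/

import Mathlib

open Filter

/-- `α_1 = 2` and `α_k = ρ(k, α_{k-1})` for `k ≥ 2`, where
`ρ(k,t) = (√(4 + (k−1)·k·t²) − 2)/(k−1)`. -/
noncomputable def alphaSeq : ℕ → ℝ
  | 0 => 0
  | 1 => 2
  | (k+2) => (Real.sqrt (4 + ((k+1 : ℕ) : ℝ) * ((k+2 : ℕ) : ℝ) * alphaSeq (k+1) ^ 2) - 2)
      / ((k+1 : ℕ) : ℝ)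

lemma alphaSeq_aux_nonneg (k : ℕ) : 0 ≤ alphaSeq k := by
  match k with
  | 0 => simp [alphaSeq]
  | 1 => simp [alphaSeq]
  | (k+2) =>
    rw [alphaSeq]
    apply div_nonneg _ (by positivity)
    rw [sub_nonneg]
    apply Real.le_sqrt_of_sq_le
    have : 0 ≤ ((k+1 : ℕ) : ℝ) * ((k+2 : ℕ) : ℝ) * alphaSeq (k+1) ^ 2 := by positivity
    linarith

lemma alphaSeq_aux_step (k : ℕ) (a b : ℝ) (ha : alphaSeq (k+1) ≤ a) (hb : 0 ≤ b)
    (h : 4 + ((k:ℝ)+1) * (k+2) * a ^ 2 ≤ (2 + (k+1) * b) ^ 2) : alphaSeq (k+2) ≤ b := by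
  rw [alphaSeq, div_le_iff₀ (by positivity), sub_le_iff_le_add]
  apply Real.sqrt_le_iff.mpr
  refine ⟨by positivity, ?_⟩
  have h1 : alphaSeq (k+1) ^ 2 ≤ a ^ 2 := pow_le_pow_left₀ (alphaSeq_aux_nonneg _) ha 2
  have h2 : ((k:ℝ)+1) * (k+2) * alphaSeq (k+1) ^ 2 ≤ ((k:ℝ)+1) * (k+2) * a ^ 2 := by gcongr
  push_cast
  nlinarith

lemma alphaSeq_aux_tail (m : ℕ) :
    alphaSeq (m+5) ≤ 4 / ((m:ℝ)+8) * Real.exp (-(1/320) * 2 ^ (m+5)) ∧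
      alphaSeq 1 ≤ 2 ∧ alphaSeq 2 ≤ 2 ∧ alphaSeq 3 ≤ 2 ∧ alphaSeq 4 ≤ 2 := by
  have h1 : alphaSeq 1 ≤ 2 := by simp [alphaSeq]
  have h2 : alphaSeq 2 ≤ 1.4642 := alphaSeq_aux_step 0 _ _ h1 (by norm_num) (by norm_num)
  have h3 : alphaSeq 3 ≤ 1.0533 := alphaSeq_aux_step 1 _ _ h2 (by norm_num) (by norm_num)
  have h4 : alphaSeq 4 ≤ 0.7204 := alphaSeq_aux_step 2 _ _ h3 (by norm_num) (by norm_num)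
  have h5 : alphaSeq 5 ≤ 0.45 := alphaSeq_aux_step 3 _ _ h4 (by norm_num) (by norm_num)
  refine ⟨?_, h1, by linarith, by linarith, by linarith⟩
  induction m with
  | zero =>
    have := Real.add_one_le_exp (-(1/320) * 2 ^ (0+5) : ℝ)
    norm_num at this ⊢
    linarith
  | succ m ih =>
    have he : Real.exp (-(1/320) * 2 ^ (m+1+5)) = Real.exp (-(1/320) * 2 ^ (m+5)) ^ 2 := by
      rw [← Real.exp_nat_mul]
      congr 1
      push_cast
      ring
    rw [he]
    set E := Real.exp (-(1/320) * 2 ^ (m+5))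
    have hm : (0:ℝ) ≤ m := Nat.cast_nonneg m
    refine alphaSeq_aux_step (m+4) _ _ ih (by positivity) ?_
    push_cast
    have key : ((m:ℝ)+4+2) * (4 / ((m:ℝ)+8)) ^ 2 ≤ 4 * (4 / ((m:ℝ)+1+8)) := by
      rw [div_pow, mul_div_assoc', mul_div_assoc', div_le_div_iff₀ (by positivity) (by positivity)]
      nlinarith
    have key2 : ((m:ℝ)+4+1) * E^2 * (((m:ℝ)+4+2) * (4 / ((m:ℝ)+8)) ^ 2)
        ≤ ((m:ℝ)+4+1) * E^2 * (4 * (4 / ((m:ℝ)+1+8))) := by gcongr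
    have key3 : 0 ≤ (((m:ℝ)+4+1) * (4 / ((m:ℝ)+1+8) * E^2))^2 := by positivity
    rw [mul_pow]
    nlinarith

/-- The sequence `(α_k)` decays doubly exponentially: there exist constants `c > 0`
and `C > 0` such that `α_k ≤ C·exp(−c·2^k)` for all `k ≥ 1`. -/
theorem alphaSeq_doubly_exponential_decay :
    ∃ c C : ℝ, 0 < c ∧ 0 < C ∧
      ∀ k : ℕ, 1 ≤ k → alphaSeq k ≤ C * Real.exp (-c * 2 ^ k) := by
  refine ⟨1/320, 4, by norm_num, by norm_num, ?_⟩
  intro k hk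
  by_cases h : k < 5
  · obtain ⟨-, h1, h2, h3, h4⟩ := alphaSeq_aux_tail 0
    have := Real.add_one_le_exp (-(1/320) * 2 ^ k : ℝ)
    interval_cases k <;> norm_num at this ⊢ <;> linarith
  · obtain ⟨m, rfl⟩ : ∃ m, k = m + 5 := ⟨k - 5, by omega⟩
    refine (alphaSeq_aux_tail m).1.trans ?_
    have hm : (0:ℝ) ≤ m := Nat.cast_nonneg m
    gcongr
    apply div_le_self (by norm_num)
    linarith
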